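/- arXiv:1905.05368 — 2 statements merged into one kernel-verified Lean document; each statement's English description precedes it below -/
import Mathlib

section
/- (Theorem 1, backward direction.) If μ : M → Option N is a stable matching, then the profile b defined by b m = μ m for every m is a pure Nash equilibrium of the game G, and the induced matching satisfies μ_b = μ. -/
open scoped Classical

variable {M N : Type*} [DecidableEq M]

/-- `chosen s b n m` : under profile `b`, CU `m` proposes to D2D pair `n` and is the
(unique, since `s · n` is injective) maximizer of `s · n` among the CUs proposing to `n`;
i.e. `Ch_n b = m`. -/
def chosen (s : M → N → ℝ) (b : M → Option N) (n : N) (m : M) : Prop :=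
  b m = some n ∧ ∀ m', b m' = some n → s m' n ≤ s m n

/-- CU `m`'s payoff `π_m b` in the game `G` (Eq. (8)): `u m n − θ` if its proposal to `n`
is accepted, `−θ` if it is rejected, and `0` if it refuses to cooperate. -/
noncomputable def payoff (u s : M → N → ℝ) (θ : ℝ) (b : M → Option N) (m : M) : ℝ :=
  match b m with
  | none => 0
  | some n => if chosen s b n m then u m n - θ else -θ

/-- A pure Nash equilibrium of `G`: no CU has a profitable unilateral deviation. -/
def isPNE (u s : M → N → ℝ) (θ : ℝ) (b : M → Option N) : Prop :=
  ∀ m (a : Option N), payoff u s θ (Function.update b m a) m ≤ payoff u s θ b m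

/-- The matching `μ_b` induced by an action profile `b`:
`μ_b m = some n` iff `b m = some n` and `Ch_n b = m`. -/
noncomputable def inducedMatching (s : M → N → ℝ) (b : M → Option N) (m : M) : Option N :=
  match b m with
  | none => none
  | some n => if chosen s b n m then some n else none

/-- `μ` is a matching: no two CUs are matched with the same D2D pair. -/
def isMatching (μ : M → Option N) : Prop :=
  ∀ m m' n, μ m = some n → μ m' = some n → m = m'

/-- Individual rationality: every matched CU gets positive utility. -/
def indivRational (u : M → N → ℝ) (μ : M → Option N) : Prop :=
  ∀ m n, μ m = some n → 0 < u m n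

/-- `(m, n)` is a blocking pair for `μ`: they are not matched together, CU `m` strictly
prefers `n` to its current situation, and D2D pair `n` strictly prefers `m` to any CU
currently matched with it. -/
def blocks (u s : M → N → ℝ) (μ : M → Option N) (m : M) (n : N) : Prop :=
  μ m ≠ some n ∧
  (∀ n', μ m = some n' → u m n' < u m n) ∧
  (μ m = none → 0 < u m n) ∧
  (∀ m', μ m' = some n → s m' n < s m n)

/-- `μ` is a stable matching: a matching that is individually rational and admits no
blocking pair. -/
def isStable (u s : M → N → ℝ) (μ : M → Option N) : Prop :=
  isMatching μ ∧ indivRational u μ ∧ ∀ m n, ¬ blocks u s μ m n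

/-- In a matching, every matched CU is the only proposer to its D2D pair, hence is chosen. -/
theorem isMatching.chosen_of_eq_some {M N : Type*} {s : M → N → ℝ} {μ : M → Option N}
    (hμ : isMatching μ) {m : M} {n : N} (h : μ m = some n) : chosen s μ n m :=
  ⟨h, fun m' h' => by rw [hμ m' m n h' h]⟩

theorem isMatching.inducedMatching_eq {M N : Type*} {s : M → N → ℝ} {μ : M → Option N}
    (hμ : isMatching μ) : inducedMatching s μ = μ := by
  funext m
  cases h : μ m with
  | none => simp [inducedMatching, h]
  | some n => simp [inducedMatching, h, hμ.chosen_of_eq_some h]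

theorem payoff_eq_zero {M N : Type*} {u s : M → N → ℝ} {θ : ℝ} {b : M → Option N} {m : M}
    (h : b m = none) : payoff u s θ b m = 0 := by
  simp [payoff, h]

theorem payoff_of_chosen {M N : Type*} {u s : M → N → ℝ} {θ : ℝ} {b : M → Option N} {m : M}
    {n : N} (h : chosen s b n m) : payoff u s θ b m = u m n - θ := by
  simp [payoff, h.1, h]

theorem payoff_of_not_chosen {M N : Type*} {u s : M → N → ℝ} {θ : ℝ} {b : M → Option N} {m : M}
    {n : N} (hb : b m = some n) (h : ¬ chosen s b n m) : payoff u s θ b m = -θ := by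
  simp [payoff, hb, h]

/-- If a CU outside `n` would be chosen after deviating to `n`, then `n` strictly prefers it to
every CU currently proposing to `n`. -/
theorem lt_of_chosen_update {M N : Type*} [DecidableEq M] {s : M → N → ℝ} {b : M → Option N}
    {m m' : M} {n : N} (hs : Function.Injective fun m => s m n) (hm : b m ≠ some n)
    (h : chosen s (Function.update b m (some n)) n m) (hm' : b m' = some n) :
    s m' n < s m n := by
  have hne : m' ≠ m := by
    rintro rfl
    exact hm hm'
  exact lt_of_le_of_ne (h.2 m' (by rwa [Function.update_of_ne hne])) fun e => hne (hs e)

theorem isStable.payoff_nonneg {M N : Type*} {u s : M → N → ℝ} {θ : ℝ} {μ : M → Option N}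
    (hθu : ∀ m n, 0 < u m n → θ < u m n) (hμ : isStable u s μ) (m : M) :
    0 ≤ payoff u s θ μ m := by
  cases h : μ m with
  | none => rw [payoff_eq_zero h]
  | some n =>
    rw [payoff_of_chosen (hμ.1.chosen_of_eq_some h)]
    linarith [hθu m n (hμ.2.1 m n h)]

theorem isStable.isPNE {M N : Type*} [DecidableEq M] {u s : M → N → ℝ} {θ : ℝ}
    {μ : M → Option N} (hs : ∀ n, Function.Injective fun m => s m n) (hθ : 0 < θ)
    (hθu : ∀ m n, 0 < u m n → θ < u m n) (hμ : isStable u s μ) : isPNE u s θ μ := by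
  intro m a
  have h0 := hμ.payoff_nonneg hθu m
  rcases a with _ | n
  · rwa [payoff_eq_zero (Function.update_self m none μ)]
  by_cases hm : μ m = some n
  · rw [← hm, Function.update_eq_self]
  by_cases hc : chosen s (Function.update μ m (some n)) n m
  · rw [payoff_of_chosen hc]
    by_contra! hlt
    refine hμ.2.2 m n ⟨hm, fun n' hn' => ?_, fun _ => by linarith,
      fun m' hm' => lt_of_chosen_update (hs n) hm hc hm'⟩
    rw [payoff_of_chosen (hμ.1.chosen_of_eq_some hn')] at hlt
    linarith
  · rw [payoff_of_not_chosen (Function.update_self m (some n) μ) hc]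
    linarith

/-- Theorem 1 (backward direction): if `μ` is a stable matching, then the profile in which
every CU `m` plays `μ m` is a pure Nash equilibrium of `G`, and it induces `μ` itself. -/
theorem stable_gives_pne
    {M N : Type*} [Fintype M] [Nonempty M] [DecidableEq M] [Fintype N] [Nonempty N]
    (u s : M → N → ℝ) (θ : ℝ)
    (hs : ∀ n, Function.Injective fun m => s m n)
    (hθ : 0 < θ) (hθu : ∀ m n, 0 < u m n → θ < u m n)
    (μ : M → Option N) (hμ : isStable u s μ) :
    isPNE u s θ μ ∧ inducedMatching s μ = μ :=
  ⟨hμ.isPNE hs hθ hθu, hμ.1.inducedMatching_eq⟩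
end

section
/- (Blocking-pair step in the proofs of Theorems 1 and 2.) Let b : M → Option N be a profile and suppose the pair (m, n) blocks the induced matching μ_b. Then the profile b' obtained from b by replacing m's action with some n satisfies Ch_n b' = m (CU m is accepted by D2D pair n) and π_m b' = u m n − θ > π_m b (a strict better reply for CU m). -/
open scoped Classical

variable {M N : Type*} [DecidableEq M]

theorem inducedMatching_eq_some_iff {M N : Type*} {s : M → N → ℝ} {b : M → Option N}
    {m : M} {n : N} :
    inducedMatching s b m = some n ↔ chosen s b n m := by
  cases h : b m with
  | none => simp [inducedMatching, chosen, h]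
  | some k =>
    by_cases hk : k = n
    · subst hk
      simp [inducedMatching, h]
    · simp [inducedMatching, chosen, h, hk]

theorem payoff_nonpos_of_inducedMatching_eq_none {M N : Type*} {u s : M → N → ℝ} {θ : ℝ}
    (hθ : 0 ≤ θ) {b : M → Option N} {m : M} (h : inducedMatching s b m = none) :
    payoff u s θ b m ≤ 0 := by
  cases hb : b m with
  | none => simp [payoff, hb]
  | some n =>
    have hn : ¬ chosen s b n m := by
      simp [← inducedMatching_eq_some_iff, h]
    simp [payoff, hb, hn, hθ]

theorem exists_chosen {M N : Type*} [Finite M] (s : M → N → ℝ) {b : M → Option N} {m : M} {n : N}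
    (h : b m = some n) : ∃ m', chosen s b n m' :=
  Set.exists_max_image {m | b m = some n} (fun m => s m n) (Set.toFinite _) ⟨m, h⟩

/-- A CU that `n` strictly prefers to its current partner is accepted when it proposes to `n`. -/
theorem chosen_update [Finite M] {s : M → N → ℝ} {b : M → Option N} {m : M} {n : N}
    (h : ∀ m', chosen s b n m' → s m' n < s m n) :
    chosen s (Function.update b m (some n)) n m := by
  refine ⟨Function.update_self .., fun m' hm' => ?_⟩
  by_cases hmm : m' = m
  · rw [hmm]
  · rw [Function.update_of_ne hmm] at hm'
    obtain ⟨c, hc⟩ := exists_chosen s hm'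
    exact (hc.2 m' hm').trans (h c hc).le

/-- Blocking-pair step in the proofs of Theorems 1 and 2: if `(m, n)` blocks the induced
matching `μ_b`, then after CU `m` switches its action to `some n` it is accepted by `n`
(`Ch_n b' = m`), its payoff becomes `u m n − θ`, and this is a strict better reply. -/
theorem blocking_pair_better_reply
    {M N : Type*} [Fintype M] [Nonempty M] [DecidableEq M] [Fintype N] [Nonempty N]
    (u s : M → N → ℝ) (θ : ℝ)
    (hs : ∀ n, Function.Injective fun m => s m n)
    (hθ : 0 < θ) (hθu : ∀ m n, 0 < u m n → θ < u m n)
    (b : M → Option N) (m : M) (n : N)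
    (hblock : blocks u s (inducedMatching s b) m n) :
    chosen s (Function.update b m (some n)) n m ∧
    payoff u s θ (Function.update b m (some n)) m = u m n - θ ∧
    payoff u s θ b m < payoff u s θ (Function.update b m (some n)) m := by
  obtain ⟨-, hsome, hnone, hpref⟩ := hblock
  have hch : chosen s (Function.update b m (some n)) n m :=
    chosen_update fun m' hm' => hpref m' (inducedMatching_eq_some_iff.2 hm')
  refine ⟨hch, payoff_of_chosen hch, ?_⟩
  rw [payoff_of_chosen hch]
  cases hμ : inducedMatching s b m with
  | none =>
    exact (payoff_nonpos_of_inducedMatching_eq_none hθ.le hμ).trans_lt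
      (sub_pos.2 (hθu m n (hnone hμ)))
  | some k =>
    rw [payoff_of_chosen (inducedMatching_eq_some_iff.1 hμ)]
    exact sub_lt_sub_right (hsome k hμ) θ
end
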